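/- Hitting the metastable magnetization from zero at low temperature: let β > 1 and let s* denote the unique positive solution of tanh(βs) = s. For a constant c₃ > 0, let τ_* := min{t ≥ 0 : S⁺_t ≥ s* + c₃·n^{-1/2}} for the restricted magnetization chain. Then there is a constant C > 0 (depending on β and c₃) such that E₀[τ_*] ≤ C·n·log n for all n, where E₀ denotes expectation for the restricted magnetization chain started from magnetization 0. -/

import Mathlib

open Filter Real

namespace CW

/-- Configurations of the Curie-Weiss model on `n` vertices:
`true` encodes spin `+1` and `false` encodes spin `-1`. -/
abbrev Config (n : ℕ) := Fin n → Bool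

noncomputable section

/-- The spin (±1) at site `i`. -/
def spin {n : ℕ} (σ : Config n) (i : Fin n) : ℝ := if σ i then 1 else -1

/-- Normalized magnetization `S(σ) = n⁻¹ ∑ᵢ σ(i)`. -/
def mag {n : ℕ} (σ : Config n) : ℝ := (∑ i, spin σ i) / n

/-- `p₊(s) = (1 + tanh(βs))/2`. -/
def pPlus (β s : ℝ) : ℝ := (1 + Real.tanh (β * s)) / 2

/-- One-step transition kernel of the Glauber dynamics for the Curie-Weiss
model: a uniformly chosen site `i` is refreshed, becoming `+1` with
probability `p₊(S(σ) - σ(i)/n)`. -/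
def glauberKernel (β : ℝ) (n : ℕ) (σ η : Config n) : ℝ :=
  (1 / n) * ∑ i : Fin n,
    if ∀ j, j ≠ i → η j = σ j then
      (if η i then pPlus β (mag σ - spin σ i / n)
       else 1 - pPlus β (mag σ - spin σ i / n))
    else 0

/-- Law of the Glauber dynamics at time `t` started from `σ`. -/
def glauberLaw (β : ℝ) (n : ℕ) : ℕ → Config n → Config n → ℝ
  | 0, σ, η => if η = σ then 1 else 0
  | t + 1, σ, η => ∑ τ : Config n, glauberLaw β n t σ τ * glauberKernel β n τ η

/-- The (normalized) exponent in the Curie-Weiss measure. -/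
def cwExponent {n : ℕ} (β : ℝ) (σ : Config n) : ℝ :=
  (β / n) * ∑ i : Fin n, ∑ j : Fin n, if i < j then spin σ i * spin σ j else 0

/-- The Curie-Weiss (mean-field Ising) probability measure
`μ(σ) = Z(β)⁻¹ exp((β/n) ∑_{i<j} σ(i)σ(j))`. -/
def cwMeasure (β : ℝ) (n : ℕ) (σ : Config n) : ℝ :=
  Real.exp (cwExponent β σ) / ∑ η : Config n, Real.exp (cwExponent β η)

/-- Total variation distance between two (discrete) distributions. -/
def tvDist {Ω : Type*} [Fintype Ω] (μ ν : Ω → ℝ) : ℝ :=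
  (∑ x, |μ x - ν x|) / 2

/-- Worst-case total variation distance to stationarity at time `t`. -/
def glauberDist (β : ℝ) (n t : ℕ) : ℝ :=
  ⨆ σ : Config n, tvDist (glauberLaw β n t σ) (cwMeasure β n)

/-- The global spin flip `σ ↦ -σ`. -/
def negConfig {n : ℕ} (σ : Config n) : Config n := fun i => !(σ i)

/-- Transition kernel of the Glauber dynamics restricted to the set
`Ω⁺ = {σ : S(σ) ≥ 0}`: a candidate move `η'` is generated by the Glauber
dynamics; if `S(η') ≥ 0` the chain moves to `η'`, otherwise it moves
to `-η'`. -/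
def rKernel (β : ℝ) (n : ℕ) (σ η : Config n) : ℝ :=
  (if 0 ≤ mag η then glauberKernel β n σ η else 0) +
    (if mag (negConfig η) < 0 then glauberKernel β n σ (negConfig η) else 0)

/-- Law of the restricted Glauber dynamics at time `t` started from `σ`. -/
def rLaw (β : ℝ) (n : ℕ) : ℕ → Config n → Config n → ℝ
  | 0, σ, η => if η = σ then 1 else 0
  | t + 1, σ, η => ∑ τ : Config n, rLaw β n t σ τ * rKernel β n τ η


/-- Probability that the restricted magnetization chain started from `σ` stays
strictly below the level `b` at all times `0, 1, …, t`; that is,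
`P_σ(S⁺_0 < b, S⁺_1 < b, …, S⁺_t < b) = P_σ(τ_⋆ > t)` where
`τ_⋆ = min{t : S⁺_t ≥ b}`. -/
def surviveBelow (β : ℝ) (n : ℕ) (b : ℝ) : ℕ → Config n → ℝ
  | 0, σ => if mag σ < b then 1 else 0
  | t + 1, σ =>
      if mag σ < b then ∑ η, rKernel β n σ η * surviveBelow β n b t η else 0

theorem hasDerivAt_tanh (x : ℝ) : HasDerivAt Real.tanh (1 - Real.tanh x ^ 2) x := by
  have hc : Real.cosh x ≠ 0 := (Real.cosh_pos x).ne'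
  have h := (Real.hasDerivAt_sinh x).div (Real.hasDerivAt_cosh x) hc
  have hfun : (Real.sinh / Real.cosh : ℝ → ℝ) = Real.tanh := by
    funext y
    rw [Pi.div_apply, Real.tanh_eq_sinh_div_cosh]
  rw [hfun] at h
  refine h.congr_deriv ?_
  rw [Real.tanh_eq_sinh_div_cosh]
  field_simp

theorem tanh_strictMono : StrictMono Real.tanh := by
  refine strictMono_of_deriv_pos fun x => ?_
  rw [(hasDerivAt_tanh x).deriv]
  linarith [Real.tanh_sq_lt_one x]

theorem tanh_sub_le {x y : ℝ} (h : y ≤ x) : Real.tanh x - Real.tanh y ≤ x - y := by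
  have hd (z : ℝ) : HasDerivAt (fun z => z - Real.tanh z) (1 - (1 - Real.tanh z ^ 2)) z :=
    (hasDerivAt_id z).sub (hasDerivAt_tanh z)
  have hm : Monotone fun z => z - Real.tanh z := by
    refine monotone_of_deriv_nonneg (fun z => (hd z).differentiableAt) fun z => ?_
    rw [(hd z).deriv]
    linarith [sq_nonneg (Real.tanh z)]
  have := hm h
  simp only at this
  linarith

theorem strictConcaveOn_tanh : StrictConcaveOn ℝ (Set.Ici 0) Real.tanh := by
  have hd : Differentiable ℝ Real.tanh := fun x => (hasDerivAt_tanh x).differentiableAt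
  refine StrictAntiOn.strictConcaveOn_of_deriv (convex_Ici 0) hd.continuous.continuousOn ?_
  rw [interior_Ici]
  intro x hx y hy hxy
  rw [(hasDerivAt_tanh x).deriv, (hasDerivAt_tanh y).deriv]
  have h0 : 0 < Real.tanh x := by simpa using tanh_strictMono hx
  have h1 := tanh_strictMono hxy
  nlinarith

theorem tanh_chord {x r : ℝ} (hx : 0 ≤ x) (hr : 0 ≤ r) (hr1 : r ≤ 1) :
    r * Real.tanh x ≤ Real.tanh (r * x) := by
  have := strictConcaveOn_tanh.concaveOn.2 (Set.mem_Ici.2 hx) (Set.mem_Ici.2 le_rfl) hr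
    (sub_nonneg.2 hr1) (by ring)
  simpa using this

theorem tanh_chord_strict {x r : ℝ} (hx : 0 < x) (hr : 0 < r) (hr1 : r < 1) :
    r * Real.tanh x < Real.tanh (r * x) := by
  have := strictConcaveOn_tanh.2 (Set.mem_Ici.2 hx.le) (Set.mem_Ici.2 le_rfl) hx.ne' hr
    (sub_pos.2 hr1) (by ring)
  simpa using this

theorem pPlus_nonneg (β s : ℝ) : 0 ≤ pPlus β s := by
  have := Real.neg_one_lt_tanh (β * s)
  unfold pPlus
  linarith

theorem pPlus_le_one (β s : ℝ) : pPlus β s ≤ 1 := by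
  have := Real.tanh_lt_one (β * s)
  unfold pPlus
  linarith

/-- Probability that the magnetization chain moves up from `s`, where `ε = 1/n`. -/
def upProb (β ε s : ℝ) : ℝ := (1 - s) / 2 * pPlus β (s + ε)

/-- Probability that the magnetization chain moves down from `s`, where `ε = 1/n`. -/
def downProb (β ε s : ℝ) : ℝ := (1 + s) / 2 * (1 - pPlus β (s - ε))

theorem upProb_le_one {β ε s : ℝ} (hs : 0 ≤ s) : upProb β ε s ≤ 1 := by
  have h0 := pPlus_nonneg β (s + ε)
  have h1 := pPlus_le_one β (s + ε)
  unfold upProb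
  nlinarith

theorem upProb_ge {β ε s : ℝ} (hβ : 0 ≤ β) (hε : 0 ≤ ε) (hs : 0 ≤ s) (hs1 : s ≤ 1) :
    (1 - s) / 4 ≤ upProb β ε s := by
  have h : 0 ≤ Real.tanh (β * (s + ε)) := by
    simpa using tanh_strictMono.monotone (by positivity : 0 ≤ β * (s + ε))
  unfold upProb pPlus
  nlinarith

theorem downProb_nonneg {β ε s : ℝ} (hs : 0 ≤ s) : 0 ≤ downProb β ε s := by
  have h1 := pPlus_le_one β (s - ε)
  unfold downProb
  exact mul_nonneg (by linarith) (by linarith)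

theorem drift_eq (β ε s : ℝ) : 4 * (upProb β ε s - downProb β ε s) =
    Real.tanh (β * (s + ε)) + Real.tanh (β * (s - ε)) - 2 * s -
      s * (Real.tanh (β * (s + ε)) - Real.tanh (β * (s - ε))) := by
  unfold upProb downProb pPlus
  ring

theorem tanh_spread_le {β ε s : ℝ} (hβ : 0 ≤ β) (hε : 0 ≤ ε) :
    Real.tanh (β * (s + ε)) - Real.tanh (β * (s - ε)) ≤ 2 * β * ε := by
  have := tanh_sub_le (x := β * (s + ε)) (y := β * (s - ε)) (by nlinarith)
  linarith

theorem drift_ge {β ε s : ℝ} (hβ : 0 ≤ β) (hε : 0 ≤ ε) (hs1 : s ≤ 1) :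
    (Real.tanh (β * s) - s) / 2 - β * ε ≤ upProb β ε s - downProb β ε s := by
  have h := drift_eq β ε s
  have h1 := tanh_spread_le (s := s) hβ hε
  have h2 := tanh_strictMono.monotone (show β * s ≤ β * (s + ε) by nlinarith)
  have h3 := tanh_sub_le (x := β * s) (y := β * (s - ε)) (by nlinarith)
  have h4 : s * (Real.tanh (β * (s + ε)) - Real.tanh (β * (s - ε))) ≤ 1 * (2 * β * ε) :=
    mul_le_mul hs1 h1 (sub_nonneg.2 (tanh_strictMono.monotone (by nlinarith))) one_pos.le
  nlinarith

theorem exists_drift_near_zero {β sstar : ℝ} (hβ : 0 < β) (hs0 : 0 < sstar)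
    (hfix : Real.tanh (β * sstar) = sstar) :
    ∃ c > (0 : ℝ), c ≤ 1 ∧ ∃ ε₀ > (0 : ℝ), ∀ ε, 0 < ε → ε ≤ ε₀ → ∀ s, ε ≤ s → s ≤ sstar / 2 →
      c * s ≤ upProb β ε s - downProb β ε s := by
  set s₁ := 3 / 4 * sstar with hs₁
  have hs₁pos : 0 < s₁ := by positivity
  set κ := Real.tanh (β * s₁) / s₁ with hκ
  have hκ1 : 1 < κ := by
    rw [hκ, lt_div_iff₀ hs₁pos, one_mul]
    have := tanh_chord_strict (x := β * sstar) (r := 3 / 4) (by positivity) (by norm_num)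
      (by norm_num)
    rw [hfix] at this
    rwa [hs₁, show β * (3 / 4 * sstar) = 3 / 4 * (β * sstar) by ring]
  have hlin (s : ℝ) (h0 : 0 ≤ s) (h1 : s ≤ s₁) : κ * s ≤ Real.tanh (β * s) := by
    have := tanh_chord (x := β * s₁) (r := s / s₁) (by positivity) (by positivity)
      ((div_le_one hs₁pos).2 h1)
    rw [show s / s₁ * (β * s₁) = β * s by field_simp] at this
    calc κ * s = s / s₁ * Real.tanh (β * s₁) := by rw [hκ]; ring
      _ ≤ _ := this
  refine ⟨min 1 ((κ - 1) / 4), by positivity [sub_pos.2 hκ1], min_le_left _ _,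
    min (sstar / 4) ((κ - 1) / (2 * β)), by positivity [sub_pos.2 hκ1], ?_⟩
  intro ε hε hεle s hεs hs
  have hε1 := hεle.trans (min_le_left _ _)
  have hε2 : ε * (2 * β) ≤ κ - 1 := (le_div_iff₀ (by positivity)).1 (hεle.trans (min_le_right _ _))
  have hspos : 0 < s := hε.trans_le hεs
  have h := drift_eq β ε s
  have h1 := hlin (s + ε) (by linarith) (by linarith)
  have h2 := hlin (s - ε) (by linarith) (by linarith)
  have h3 := mul_le_mul_of_nonneg_left (tanh_spread_le (s := s) hβ.le hε.le) hspos.le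
  have h4 : min 1 ((κ - 1) / 4) * s ≤ (κ - 1) / 4 * s :=
    mul_le_mul_of_nonneg_right (min_le_right _ _) hspos.le
  nlinarith

theorem exists_drift_below {β sstar : ℝ} (hβ : 0 < β) (hs0 : 0 < sstar)
    (hfix : Real.tanh (β * sstar) = sstar) :
    ∃ c > (0 : ℝ), ∀ ε, 0 ≤ ε → ∀ s, sstar / 2 ≤ s → s ≤ sstar →
      c * (sstar - s) - β * ε ≤ upProb β ε s - downProb β ε s := by
  have hs1 : sstar < 1 := hfix ▸ Real.tanh_lt_one _
  set g := Real.tanh (β * (sstar / 2)) - sstar / 2 with hg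
  have hgpos : 0 < g := by
    have := tanh_chord_strict (x := β * sstar) (r := 1 / 2) (by positivity) (by norm_num)
      (by norm_num)
    rw [hfix, show 1 / 2 * (β * sstar) = β * (sstar / 2) by ring] at this
    linarith
  refine ⟨g / sstar, by positivity, fun ε hε s hs hs' => ?_⟩
  refine le_trans ?_ (drift_ge hβ.le hε (by linarith))
  set r := (sstar - s) / (sstar / 2) with hr
  have hr0 : 0 ≤ r := div_nonneg (by linarith) (by linarith)
  have hr1 : r ≤ 1 := (div_le_one (by linarith)).2 (by linarith)
  have hrs : r * (sstar / 2) = sstar - s := by rw [hr]; field_simp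
  have := strictConcaveOn_tanh.concaveOn.2 (x := β * (sstar / 2)) (y := β * sstar)
    (Set.mem_Ici.2 (by positivity)) (Set.mem_Ici.2 (by positivity)) hr0 (sub_nonneg.2 hr1) (by ring)
  simp only [smul_eq_mul, hfix] at this
  rw [show r * (β * (sstar / 2)) + (1 - r) * (β * sstar) = β * s by
    linear_combination (-β) * hrs] at this
  have h2 : g / sstar * (sstar - s) = r * g / 2 := by
    rw [hr]; field_simp
  rw [h2]
  nlinarith

theorem drift_above {β sstar ε s : ℝ} (hβ : 0 < β)
    (hfix : Real.tanh (β * sstar) = sstar) (hε : 0 ≤ ε) (hs : sstar ≤ s) (hs1 : s ≤ 1) :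
    -(s - sstar) - β * ε ≤ upProb β ε s - downProb β ε s := by
  have h := drift_ge hβ.le hε hs1
  have h1 := tanh_strictMono.monotone (show β * sstar ≤ β * s by nlinarith)
  rw [hfix] at h1
  linarith

/-- The number of sites with spin `+1`, as an integer. -/
def plusCount {n : ℕ} (σ : Config n) : ℤ := ∑ i, if σ i then 1 else 0

theorem sum_spin {n : ℕ} (σ : Config n) : ∑ i, spin σ i = 2 * (plusCount σ : ℝ) - n := by
  have : ∀ i, spin σ i = 2 * ((if σ i then 1 else 0 : ℤ) : ℝ) - 1 := by
    intro i
    unfold spin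
    split_ifs <;> norm_num
  rw [Finset.sum_congr rfl fun i _ => this i, Finset.sum_sub_distrib, ← Finset.mul_sum, plusCount]
  simp

theorem mag_eq {n : ℕ} (σ : Config n) : mag σ = (2 * (plusCount σ : ℝ) - n) / n := by
  rw [mag, sum_spin]

theorem plusCount_negConfig {n : ℕ} (σ : Config n) :
    plusCount (negConfig σ) = n - plusCount σ := by
  rw [eq_sub_iff_add_eq, plusCount, plusCount, ← Finset.sum_add_distrib]
  have : ∀ i, ((if negConfig σ i then 1 else 0 : ℤ) + if σ i then 1 else 0) = 1 := by
    intro i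
    cases h : σ i <;> simp [negConfig, h]
  simp [this]

theorem negConfig_negConfig {n : ℕ} (σ : Config n) : negConfig (negConfig σ) = σ := by
  funext i
  simp [negConfig]

theorem mag_negConfig {n : ℕ} (σ : Config n) : mag (negConfig σ) = -mag σ := by
  rw [mag_eq, mag_eq, plusCount_negConfig]
  push_cast
  ring

theorem plusCount_update {n : ℕ} (σ : Config n) (i : Fin n) (b : Bool) :
    plusCount (Function.update σ i b) =
      plusCount σ + ((if b then 1 else 0) - if σ i then 1 else 0) := by
  have h : ∀ j, (if Function.update σ i b j then 1 else 0 : ℤ) = (if σ j then 1 else 0) +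
      if j = i then ((if b then 1 else 0) - if σ i then 1 else 0) else 0 := by
    intro j
    by_cases hj : j = i
    · subst hj; simp
    · simp [hj]
  rw [plusCount, Finset.sum_congr rfl fun j _ => h j, Finset.sum_add_distrib, plusCount]
  simp

theorem glauberKernel_nonneg (β : ℝ) (n : ℕ) (σ η : Config n) : 0 ≤ glauberKernel β n σ η := by
  refine mul_nonneg (by positivity) (Finset.sum_nonneg fun i _ => ?_)
  split_ifs
  · exact pPlus_nonneg _ _
  · exact sub_nonneg.2 (pPlus_le_one _ _)
  · exact le_rfl

theorem rKernel_nonneg (β : ℝ) (n : ℕ) (σ η : Config n) : 0 ≤ rKernel β n σ η := by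
  unfold rKernel
  have h1 := glauberKernel_nonneg β n σ η
  have h2 := glauberKernel_nonneg β n σ (negConfig η)
  split_ifs <;> linarith

theorem rKernel_eq_zero {β : ℝ} {n : ℕ} {σ η : Config n} (h : mag η < 0) :
    rKernel β n σ η = 0 := by
  rw [rKernel, if_neg h.not_ge, mag_negConfig, if_neg (by linarith), add_zero]

theorem sum_rKernel_mul (β : ℝ) (n : ℕ) (σ : Config n) (F : Config n → ℝ)
    (hF : ∀ η, F (negConfig η) = F η) :
    ∑ η, rKernel β n σ η * F η = ∑ η, glauberKernel β n σ η * F η := by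
  have hinv : Function.Involutive (negConfig : Config n → Config n) := negConfig_negConfig
  have h : ∑ η, (if mag (negConfig η) < 0 then glauberKernel β n σ (negConfig η) else 0) * F η =
      ∑ η, (if mag η < 0 then glauberKernel β n σ η else 0) * F η := by
    refine Fintype.sum_equiv hinv.toPerm _ _ fun η => ?_
    simp only [Function.Involutive.coe_toPerm, hF]
    rfl
  simp only [rKernel, add_mul, Finset.sum_add_distrib]
  rw [h, ← Finset.sum_add_distrib]
  refine Finset.sum_congr rfl fun η _ => ?_
  by_cases h0 : 0 ≤ mag η
  · simp [h0, h0.not_gt]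
  · simp [h0, not_le.1 h0]

theorem sum_glauberKernel_mul (β : ℝ) (n : ℕ) (σ : Config n) (F : Config n → ℝ) :
    ∑ η, glauberKernel β n σ η * F η = (1 / n) * ∑ i,
      (pPlus β (mag σ - spin σ i / n) * F (Function.update σ i true) +
        (1 - pPlus β (mag σ - spin σ i / n)) * F (Function.update σ i false)) := by
  simp only [glauberKernel, mul_assoc, ← Finset.mul_sum, Finset.sum_mul]
  congr 1
  rw [Finset.sum_comm]
  refine Finset.sum_congr rfl fun i _ => ?_
  have hne : Function.update σ i true ≠ Function.update σ i false := fun h => by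
    simpa using congrFun h i
  rw [Fintype.sum_eq_add _ _ hne]
  · simp +contextual
  · intro η hη
    rw [if_neg, zero_mul]
    intro h
    have hupd : η = Function.update σ i (η i) := by
      funext j
      by_cases hj : j = i
      · subst hj; simp
      · simp [hj, h j hj]
    cases hi : η i <;> rw [hi] at hupd
    · exact hη.2 hupd
    · exact hη.1 hupd

theorem sum_glauberKernel_mul_plusCount (β : ℝ) {n : ℕ} (hn : 0 < n) (σ : Config n) (φ : ℤ → ℝ) :
    ∑ η, glauberKernel β n σ η * φ (plusCount η) = φ (plusCount σ) +
      upProb β (1 / n) (mag σ) * (φ (plusCount σ + 1) - φ (plusCount σ)) +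
      downProb β (1 / n) (mag σ) * (φ (plusCount σ - 1) - φ (plusCount σ)) := by
  have hn' : (n : ℝ) ≠ 0 := by positivity
  set N := plusCount σ with hN
  set A := pPlus β (mag σ + 1 / n) * (φ (N + 1) - φ N) with hA
  set B := (1 - pPlus β (mag σ - 1 / n)) * (φ (N - 1) - φ N) with hB
  rw [sum_glauberKernel_mul]
  have h : ∀ i, pPlus β (mag σ - spin σ i / n) * φ (plusCount (Function.update σ i true)) +
      (1 - pPlus β (mag σ - spin σ i / n)) * φ (plusCount (Function.update σ i false)) =
      φ N + (A + B) / 2 + spin σ i * ((B - A) / 2) := by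
    intro i
    rw [plusCount_update, plusCount_update, ← hN]
    cases hi : σ i
    · simp only [spin, hi]
      simp [neg_div, sub_neg_eq_add, hA, hB]
      ring
    · simp only [spin, hi]
      simp [← sub_eq_add_neg, hA, hB]
      ring
  rw [Finset.sum_congr rfl fun i _ => h i, Finset.sum_add_distrib, ← Finset.sum_mul]
  have hs : ∑ i, spin σ i = mag σ * n := by rw [mag]; field_simp
  rw [hs]
  simp only [Finset.sum_const, Finset.card_univ, Fintype.card_fin, nsmul_eq_mul, upProb, downProb]
  rw [mul_assoc _ _ (φ (N + 1) - φ N), mul_assoc _ _ (φ (N - 1) - φ N), ← hA, ← hB]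
  field_simp
  ring

theorem surviveBelow_nonneg (β : ℝ) (n : ℕ) (b : ℝ) (t : ℕ) (σ : Config n) :
    0 ≤ surviveBelow β n b t σ := by
  induction t generalizing σ with
  | zero => unfold surviveBelow; split_ifs <;> norm_num
  | succ t ih =>
    unfold surviveBelow
    split_ifs
    · exact Finset.sum_nonneg fun η _ => mul_nonneg (rKernel_nonneg _ _ _ _) (ih η)
    · exact le_rfl

theorem surviveBelow_eq_zero {β : ℝ} {n : ℕ} {b : ℝ} {σ : Config n} (h : b ≤ mag σ) (t : ℕ) :
    surviveBelow β n b t σ = 0 := by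
  cases t <;> simp [surviveBelow, h.not_gt]

/-- A Lyapunov function decreasing by at least one per step in mean below the level `b`
dominates the expected time to reach `b`. -/
theorem sum_surviveBelow_le {β : ℝ} {n : ℕ} {b : ℝ} {F : Config n → ℝ} (hF : ∀ σ, 0 ≤ F σ)
    (hstep : ∀ σ, 0 ≤ mag σ → mag σ < b → 1 + ∑ η, rKernel β n σ η * F η ≤ F σ)
    (T : ℕ) (σ : Config n) (hσ : 0 ≤ mag σ) :
    ∑ t ∈ Finset.range T, surviveBelow β n b t σ ≤ F σ := by
  induction T generalizing σ with
  | zero => simpa using hF σ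
  | succ T ih =>
    by_cases hb : mag σ < b
    · rw [Finset.sum_range_succ']
      simp only [surviveBelow, if_pos hb]
      rw [Finset.sum_comm]
      simp only [← Finset.mul_sum]
      refine le_trans ?_ (hstep σ hσ hb)
      rw [add_comm]
      gcongr 1 + ∑ η, ?_ with η
      by_cases hη : 0 ≤ mag η
      · exact mul_le_mul_of_nonneg_left (ih η hη) (rKernel_nonneg _ _ _ _)
      · rw [rKernel_eq_zero (not_le.1 hη), zero_mul, zero_mul]
    · rw [Finset.sum_eq_zero fun t _ => surviveBelow_eq_zero (not_lt.1 hb) t]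
      exact hF σ

/-- Expected time to climb from `k` to `k + 1` for a birth-death chain on `ℕ` with upward
probabilities `p` and downward probabilities `q`. -/
def climbTime (p q : ℕ → ℝ) : ℕ → ℝ
  | 0 => 1 / p 0
  | k + 1 => (1 + q (k + 1) * climbTime p q k) / p (k + 1)

theorem climbTime_succ_le {p q : ℕ → ℝ} {k : ℕ} {H H' : ℝ} (hp : 0 < p (k + 1))
    (hq : 0 ≤ q (k + 1)) (hH : climbTime p q k ≤ H)
    (h : 1 + q (k + 1) * H ≤ p (k + 1) * H') : climbTime p q (k + 1) ≤ H' := by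
  rw [climbTime, div_le_iff₀ hp, mul_comm H']
  exact le_trans (by gcongr) h

theorem climbTime_nonneg {p q : ℕ → ℝ} {k : ℕ} (hp : ∀ j ≤ k, 0 ≤ p j) (hq : ∀ j ≤ k, 0 ≤ q j) :
    0 ≤ climbTime p q k := by
  induction k with
  | zero => exact one_div_nonneg.2 (hp 0 le_rfl)
  | succ k ih =>
    have := ih (fun j hj => hp j (hj.trans k.le_succ)) (fun j hj => hq j (hj.trans k.le_succ))
    exact div_nonneg (add_nonneg one_pos.le (mul_nonneg (hq _ le_rfl) this)) (hp _ le_rfl)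

theorem climbTime_le_linear {p q : ℕ → ℝ} {a : ℝ} {K : ℕ} (ha : 0 < a)
    (hpa : ∀ k ≤ K, a ≤ p k) (hq : ∀ k ≤ K, 0 ≤ q k)
    (hd : ∀ k, 1 ≤ k → k ≤ K → q k ≤ p k) (k : ℕ) (hk : k ≤ K) :
    climbTime p q k ≤ (k + 1) / a := by
  induction k with
  | zero =>
    rw [climbTime]
    simpa using one_div_le_one_div_of_le ha (hpa 0 hk)
  | succ k ih =>
    have hp := hpa _ hk
    refine climbTime_succ_le (ha.trans_le hp) (hq _ hk) (ih (by omega)) ?_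
    have h1 : 1 ≤ p (k + 1) / a := (one_le_div ha).2 hp
    have h2 : q (k + 1) * ((k + 1) / a) ≤ p (k + 1) * ((k + 1) / a) :=
      mul_le_mul_of_nonneg_right (hd _ (by omega) hk) (by positivity)
    have h3 : p (k + 1) * (((k + 1 : ℕ) + 1) / a) = p (k + 1) * ((k + 1) / a) + p (k + 1) / a := by
      push_cast
      ring
    rw [h3]
    linarith

theorem climbTime_le_of_linear_drift {p q : ℕ → ℝ} {a c n : ℝ} {K : ℕ} (ha : 0 < a) (ha1 : a ≤ 1)
    (hc : 0 < c) (hc1 : c ≤ 1) (hn : 1 ≤ n) (hpa : ∀ k ≤ K, a ≤ p k) (hp1 : ∀ k ≤ K, p k ≤ 1)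
    (hq : ∀ k ≤ K, 0 ≤ q k) (hd : ∀ k : ℕ, 1 ≤ k → k ≤ K → c * (k / n) ≤ p k - q k)
    (k : ℕ) (hk : k ≤ K) : climbTime p q k ≤ 4 / (a * c) * n / (k + 1) := by
  have hn0 : 0 < n := by linarith
  have hlin := climbTime_le_linear ha hpa hq fun j hj hj' => by
    have := hd j hj hj'
    have : 0 ≤ c * (j / n) := by positivity
    linarith
  have hsmall (j : ℕ) (hj : j ≤ K) (h : ((j : ℝ) + 1) ^ 2 * c ≤ 4 * n) :
      climbTime p q j ≤ 4 / (a * c) * n / (j + 1) := by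
    refine (hlin j hj).trans ?_
    rw [div_le_div_iff₀ ha (by positivity), show 4 / (a * c) * n * a = 4 * n / c by field_simp,
      le_div_iff₀ hc]
    linarith
  induction k with
  | zero => exact hsmall 0 hk (by norm_num; linarith)
  | succ k ih =>
    have hk1 : (1 : ℝ) ≤ (k + 1 : ℕ) := by push_cast; linarith [(Nat.cast_nonneg k : (0 : ℝ) ≤ k)]
    set x : ℝ := ((k + 1 : ℕ) : ℝ) with hx
    by_cases h : x * (x + 1) * c ≤ 2 * n
    · refine hsmall _ hk ?_
      nlinarith [mul_nonneg (mul_nonneg hc.le (by linarith : 0 ≤ x + 1))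
        (by linarith : 0 ≤ x - 1)]
    · have hp := hpa _ hk
      refine climbTime_succ_le (ha.trans_le hp) (hq _ hk) (ih (by omega)) ?_
      rw [show (k : ℝ) + 1 = x by rw [hx]; push_cast; rfl]
      have hxpos : 0 < x := by linarith
      set P := p (k + 1)
      set Q := q (k + 1)
      have hd' : c * (x / n) ≤ P - Q := hd (k + 1) (by omega) hk
      have hP1 : P ≤ 1 := hp1 _ hk
      set B := 4 / (a * c) with hB
      have hBc : 4 ≤ B * c := by
        rw [hB, show 4 / (a * c) * c = 4 / a by field_simp, le_div_iff₀ ha]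
        linarith
      have hBpos : 0 < B := by positivity
      have e1 : c * B ≤ (P - Q) * (B * n / x) := by
        calc c * B = c * (x / n) * (B * n / x) := by field_simp
          _ ≤ _ := mul_le_mul_of_nonneg_right hd' (by positivity)
      have e2 : B * n / x - B * n / (x + 1) = B * n / (x * (x + 1)) := by field_simp; ring
      have e3 : P * (B * n / (x * (x + 1))) ≤ B * c / 2 := by
        refine (mul_le_of_le_one_left (by positivity) hP1).trans ?_
        rw [div_le_iff₀ (by positivity)]
        nlinarith [not_le.1 h]
      rw [← e2] at e3
      nlinarith

theorem climbTime_le_of_drift_toward {p q x : ℕ → ℝ} {a c C δ B : ℝ} {K₁ K₂ : ℕ} (ha : 0 < a)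
    (hc : 0 < c) (hδ : 0 < δ) (hδ1 : δ ≤ 1 / 2) (hCa : 2 * C * δ ≤ a) (hCc : 2 * C * δ ≤ c)
    (hC : 0 ≤ C) (hBa : 6 ≤ B * a) (hBc : 6 ≤ B * c)
    (hpa : ∀ k, K₁ < k → k ≤ K₂ → a ≤ p k) (hq : ∀ k, K₁ < k → k ≤ K₂ → 0 ≤ q k)
    (hx : ∀ k, x k = x (k + 1) + 2 * δ ^ 2) (hx0 : ∀ k ≤ K₂, 0 ≤ x k)
    (hd : ∀ k, K₁ < k → k ≤ K₂ → c * x k - C * δ ^ 2 ≤ p k - q k)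
    (h0 : climbTime p q K₁ ≤ B / (x K₁ + δ)) (k : ℕ) (hk₁ : K₁ ≤ k) (hk : k ≤ K₂) :
    climbTime p q k ≤ B / (x k + δ) := by
  induction k, hk₁ using Nat.le_induction with
  | base => exact h0
  | succ k hk1 ih =>
    have hp := hpa (k + 1) (by omega) hk
    have hd' := hd (k + 1) (by omega) hk
    refine climbTime_succ_le (ha.trans_le hp) (hq _ (by omega) hk) (ih (by omega)) ?_
    rw [hx k]
    have hy := hx0 (k + 1) hk
    set y := x (k + 1)
    set P := p (k + 1)
    set Q := q (k + 1)
    have hB : 0 < B := by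
      by_contra hB
      nlinarith
    have key : (y + δ) * (y + 2 * δ ^ 2 + δ) ≤ B * ((P - Q) * (y + δ) + 2 * δ ^ 2 * P) := by
      have h1 : B * ((c * y - C * δ ^ 2) * (y + δ) + 2 * δ ^ 2 * a) ≤
          B * ((P - Q) * (y + δ) + 2 * δ ^ 2 * P) := by gcongr
      refine le_trans ?_ h1
      have hδ2 : 2 * δ ^ 2 ≤ δ := by nlinarith
      rcases le_total y δ with hyδ | hyδ
      · have e1 : (y + δ) * (y + 2 * δ ^ 2 + δ) ≤ (2 * δ) * (3 * δ) := by
          gcongr <;> linarith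
        have e2 : C * δ ^ 2 * (y + δ) ≤ a * δ ^ 2 := by
          calc C * δ ^ 2 * (y + δ) ≤ C * δ ^ 2 * (2 * δ) := by gcongr; linarith
            _ = 2 * C * δ * δ ^ 2 := by ring
            _ ≤ _ := by gcongr
        have e3 : 0 ≤ c * y * (y + δ) := by positivity
        have e4 : B * (a * δ ^ 2) ≤
            B * ((c * y - C * δ ^ 2) * (y + δ) + 2 * δ ^ 2 * a) := by
          gcongr
          linarith
        have e5 : 6 * δ ^ 2 ≤ B * a * δ ^ 2 := by gcongr
        linarith
      · have e1 : C * δ ^ 2 ≤ c / 2 * y := by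
          calc C * δ ^ 2 = C * δ * δ := by ring
            _ ≤ c / 2 * y := by gcongr; linarith
        have e2 : B * (c / 2 * y * (y + δ)) ≤
            B * ((c * y - C * δ ^ 2) * (y + δ) + 2 * δ ^ 2 * a) := by
          gcongr
          have : c / 2 * y * (y + δ) ≤ (c * y - C * δ ^ 2) * (y + δ) := by
            gcongr
            linarith
          have : 0 ≤ 2 * δ ^ 2 * a := by positivity
          linarith
        have e3 : (y + δ) * (y + 2 * δ ^ 2 + δ) ≤ (y + δ) * (3 * y) := by
          gcongr
          linarith
        have e4 : 6 * (y * (y + δ)) ≤ B * c * (y * (y + δ)) := by gcongr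
        linarith
    have hz : 0 < y + δ := by linarith
    have hz2 : 0 < y + 2 * δ ^ 2 + δ := by positivity
    have e : P * (B / (y + δ)) - Q * (B / (y + 2 * δ ^ 2 + δ)) =
        B * ((P - Q) * (y + δ) + 2 * δ ^ 2 * P) / ((y + δ) * (y + 2 * δ ^ 2 + δ)) := by
      field_simp
      ring
    have : 1 ≤ P * (B / (y + δ)) - Q * (B / (y + 2 * δ ^ 2 + δ)) := by
      rw [e, one_le_div (by positivity)]
      exact key
    linarith

theorem climbTime_le_of_drift_ge {p q : ℕ → ℝ} {a D δ B : ℝ} {K L : ℕ} (ha : 0 < a)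
    (hD : 0 ≤ D) (hδ : 0 < δ) (hB : 1 ≤ B) (hpa : ∀ j < L, a ≤ p (K + 1 + j))
    (hq : ∀ j < L, 0 ≤ q (K + 1 + j)) (hd : ∀ j < L, -D * δ ≤ p (K + 1 + j) - q (K + 1 + j))
    (h0 : climbTime p q K ≤ B / δ) (j : ℕ) (hj : j ≤ L) :
    climbTime p q (K + j) ≤ B / δ * (1 + (D + 1) / a * δ) ^ j := by
  induction j with
  | zero => simpa using h0
  | succ j ih =>
    have hp := hpa j hj
    have hd' := hd j hj
    have hq' := hq j hj
    rw [show K + 1 + j = K + j + 1 by omega] at hp hd' hq'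
    rw [← add_assoc]
    refine climbTime_succ_le (ha.trans_le hp) hq' (ih (by omega)) ?_
    set P := p (K + j + 1)
    set Q := q (K + j + 1)
    set R := 1 + (D + 1) / a * δ with hR
    have hR1 : 1 ≤ R := by
      have : 0 ≤ (D + 1) / a * δ := by positivity
      linarith
    set H := B / δ * R ^ j with hH
    have hHδ : 1 ≤ δ * H := by
      rw [hH, show δ * (B / δ * R ^ j) = B * R ^ j by field_simp]
      exact one_le_mul_of_one_le_of_one_le hB (one_le_pow₀ hR1)
    have hHpos : 0 < H := by
      by_contra h
      nlinarith
    have hPR : (D + 1) * δ ≤ P * ((D + 1) / a * δ) := by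
      calc (D + 1) * δ = a * ((D + 1) / a * δ) := by field_simp
        _ ≤ _ := by gcongr
    have h1 : δ * H ≤ (P * R - Q) * H := by
      gcongr
      rw [hR]
      linarith
    have h2 : P * (B / δ * R ^ (j + 1)) = P * R * H := by rw [hH, pow_succ]; ring
    rw [h2]
    linarith

theorem sum_inv_le {n : ℝ} {K : ℕ} (hK : (K : ℝ) ≤ n) (hn : 1 ≤ n) :
    ∑ k ∈ Finset.range K, ((k : ℝ) + 1)⁻¹ ≤ 1 + Real.log n := by
  have h := harmonic_le_one_add_log K
  rw [harmonic] at h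
  push_cast at h
  refine h.trans ?_
  rcases Nat.eq_zero_or_pos K with rfl | h0
  · simpa using Real.log_nonneg hn
  · have : (0 : ℝ) < K := by exact_mod_cast h0
    gcongr

/-- The expected time for the magnetization chain to climb from level `2k/n` to `2(k+1)/n`. -/
def magClimbTime (β : ℝ) (n k : ℕ) : ℝ :=
  climbTime (fun k => upProb β (1 / n) (2 * k / n)) (fun k => downProb β (1 / n) (2 * k / n)) k

set_option maxHeartbeats 1000000 in
theorem magClimbTime_le {β sstar c₃ a c₁ c₂ δ : ℝ} {n : ℕ} (hβ : 0 < β) (hs0 : 0 < sstar)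
    (hfix : Real.tanh (β * sstar) = sstar) (hc₃ : 0 < c₃) (ha : a = (1 - sstar) / 8)
    (hc₁ : 0 < c₁) (hc₁1 : c₁ ≤ 1) (hc₂ : 0 < c₂)
    (hδ : 0 < δ) (hnδ : (1 : ℝ) / n = δ ^ 2) (hδ1 : δ ≤ 1 / 2) (hδa : 2 * β * δ ≤ a)
    (hδc : 2 * β * δ ≤ c₂) (hδs : c₃ * δ ≤ (1 - sstar) / 2)
    (hd₁ : ∀ s, (1 : ℝ) / n ≤ s → s ≤ sstar / 2 →
      c₁ * s ≤ upProb β (1 / n) s - downProb β (1 / n) s)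
    (hd₂ : ∀ s, sstar / 2 ≤ s → s ≤ sstar →
      c₂ * (sstar - s) - β * (1 / n) ≤ upProb β (1 / n) s - downProb β (1 / n) s) :
    ∑ k ∈ Finset.range ⌈(sstar + c₃ * δ) * n / 2⌉₊, magClimbTime β n k ≤
      (4 / (a * c₁) + (6 / a + 6 / c₂ + 8 * (4 / (a * c₁)) / sstar + 1) *
        (1 + (c₃ + 1) * Real.exp ((c₃ + β + 1) / a * (c₃ + 1)))) * n * (1 + Real.log n) := by
  have hs1 : sstar < 1 := hfix ▸ Real.tanh_lt_one _
  have ha0 : 0 < a := by rw [ha]; linarith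
  have ha1 : a ≤ 1 := by rw [ha]; linarith
  have hnpos : (0 : ℝ) < n := by
    have : (0 : ℝ) < 1 / n := by rw [hnδ]; positivity
    exact one_div_pos.1 this
  have hn1 : (1 : ℝ) ≤ n := by
    have : 0 < n := by exact_mod_cast hnpos
    exact_mod_cast this
  have hnδ' : n * δ ^ 2 = 1 := by rw [← hnδ]; field_simp
  set A := 4 / (a * c₁) with hA
  set B := 6 / a + 6 / c₂ + 8 * A / sstar + 1 with hB
  set E := Real.exp ((c₃ + β + 1) / a * (c₃ + 1)) with hE
  have hApos : 0 < A := by positivity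
  have hBpos : 0 < B := by positivity
  have hB1 : 1 ≤ B := by
    have : 0 < 6 / a + 6 / c₂ + 8 * A / sstar := by positivity
    linarith
  have hBa : 6 ≤ B * a := by
    rw [← div_le_iff₀ ha0, hB]
    have : 0 < 6 / c₂ + 8 * A / sstar := by positivity
    linarith
  have hBc : 6 ≤ B * c₂ := by
    rw [← div_le_iff₀ hc₂, hB]
    have : 0 < 6 / a + 8 * A / sstar := by positivity
    linarith
  have hBA : 8 * A / sstar ≤ B := by
    rw [hB]
    have : 0 < 6 / a + 6 / c₂ := by positivity
    linarith
  set M := ⌈(sstar + c₃ * δ) * n / 2⌉₊ with hM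
  set K₁ := ⌊sstar * n / 4⌋₊ with hK₁
  set K₂ := ⌊sstar * n / 2⌋₊ with hK₂
  set p : ℕ → ℝ := fun k => upProb β (1 / n) (2 * k / n) with hp
  set q : ℕ → ℝ := fun k => downProb β (1 / n) (2 * k / n) with hq
  have hMlt {k : ℕ} (h : k < M) : 2 * (k : ℝ) / n < sstar + c₃ * δ := by
    have := Nat.lt_ceil.1 h
    rw [div_lt_iff₀ hnpos]
    linarith
  have hq0 (k : ℕ) : 0 ≤ q k := downProb_nonneg (by positivity)
  have hp1 (k : ℕ) : p k ≤ 1 := upProb_le_one (by positivity)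
  have hpa {k : ℕ} (h : k < M) : a ≤ p k := by
    have := hMlt h
    refine le_trans ?_ (upProb_ge hβ.le (by positivity) (by positivity) (by linarith))
    rw [ha]
    linarith
  have hK₁le {k : ℕ} (h : k ≤ K₁) : 2 * (k : ℝ) / n ≤ sstar / 2 := by
    have := (Nat.le_floor_iff (by positivity)).1 h
    rw [div_le_iff₀ hnpos]
    linarith
  have hK₁lt {k : ℕ} (h : K₁ < k) : sstar / 2 ≤ 2 * (k : ℝ) / n := by
    have := (Nat.floor_lt (by positivity)).1 h
    rw [le_div_iff₀ hnpos]
    linarith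
  have hK₂le {k : ℕ} (h : k ≤ K₂) : 2 * (k : ℝ) / n ≤ sstar := by
    have := (Nat.le_floor_iff (by positivity)).1 h
    rw [div_le_iff₀ hnpos]
    linarith
  have hK₂lt {k : ℕ} (h : K₂ < k) : sstar ≤ 2 * (k : ℝ) / n := by
    have := (Nat.floor_lt (by positivity)).1 h
    rw [le_div_iff₀ hnpos]
    linarith
  have hK₁₂ : K₁ ≤ K₂ := Nat.floor_mono (by linarith [mul_pos hs0 hnpos])
  have hK₂M : K₂ < M := by
    rw [hM, Nat.lt_ceil]
    have := (div_le_iff₀ hnpos).1 (hK₂le le_rfl)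
    have : 0 < c₃ * δ * n := by positivity
    linarith
  have hleft (k : ℕ) (hk : k ≤ K₁) : climbTime p q k ≤ A * n / (k + 1) := by
    refine climbTime_le_of_linear_drift ha0 ha1 hc₁ hc₁1 hn1 (fun j hj => hpa (by omega))
      (fun j _ => hp1 j) (fun j _ => hq0 j) (fun j hj hj' => ?_) k hk
    have hj1 : (1 : ℝ) ≤ j := by exact_mod_cast hj
    refine le_trans ?_ (hd₁ (2 * j / n) ?_ (hK₁le hj'))
    · gcongr
      linarith
    · gcongr
      linarith
  have hmid (k : ℕ) (hk₁ : K₁ ≤ k) (hk : k ≤ K₂) :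
      climbTime p q k ≤ B / (sstar - 2 * k / n + δ) := by
    refine climbTime_le_of_drift_toward (x := fun k => sstar - 2 * k / n) ha0 hc₂ hδ hδ1 hδa hδc
      hβ.le hBa hBc (fun j _ hj => hpa (by omega)) (fun j _ _ => hq0 j) (fun j => ?_)
      (fun j hj => sub_nonneg.2 (hK₂le hj)) (fun j hj hj' => ?_) ?_ k hk₁ hk
    · rw [← hnδ]
      push_cast
      ring
    · rw [← hnδ]
      exact hd₂ _ (hK₁lt hj) (hK₂le hj')
    · refine (hleft K₁ le_rfl).trans ?_
      have h1 : sstar * n / 4 ≤ K₁ + 1 := (Nat.lt_floor_add_one _).le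
      have h2 := hK₁le le_rfl
      have h3 : 0 ≤ 2 * (K₁ : ℝ) / n := by positivity
      calc A * n / (K₁ + 1) ≤ A * n / (sstar * n / 4) := by gcongr
        _ = 8 * A / sstar / 2 := by field_simp; norm_num
        _ ≤ B / 2 := by gcongr
        _ ≤ _ := by
          gcongr
          · linarith
          · linarith
  have hmid' (k : ℕ) (hk₁ : K₁ ≤ k) (hk : k ≤ K₂) :
      climbTime p q k ≤ B * n / ((K₂ - k : ℕ) + 1) := by
    refine (hmid k hk₁ hk).trans ?_
    have h1 := (div_le_iff₀ hnpos).1 (hK₂le le_rfl)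
    have h2 : 1 ≤ δ * n := by
      have : δ ^ 2 * n ≤ δ * n := by gcongr; nlinarith
      linarith
    have h3 : (k : ℝ) ≤ K₂ := by exact_mod_cast hk
    have h4 : 0 ≤ sstar - 2 * (k : ℝ) / n := sub_nonneg.2 (hK₂le hk)
    rw [div_le_div_iff₀ (by linarith) (by positivity), mul_assoc, Nat.cast_sub hk]
    gcongr
    have h5 : (n : ℝ) * (sstar - 2 * k / n + δ) = sstar * n - 2 * k + δ * n := by field_simp
    rw [h5]
    linarith
  obtain ⟨L, hL⟩ : ∃ L, M = K₂ + 1 + L := ⟨M - (K₂ + 1), by omega⟩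
  have hLδ : δ * L ≤ c₃ + 1 := by
    have h1 : (M : ℝ) < (sstar + c₃ * δ) * n / 2 + 1 := Nat.ceil_lt_add_one (by positivity)
    have h2 : sstar * n / 2 < K₂ + 1 := Nat.lt_floor_add_one _
    rw [hL] at h1
    push_cast at h1
    have h3 : (L : ℝ) ≤ c₃ * δ * n / 2 + 1 := by linarith
    calc δ * L ≤ δ * (c₃ * δ * n / 2 + 1) := by gcongr
      _ = c₃ * (n * δ ^ 2) / 2 + δ := by ring
      _ ≤ c₃ + 1 := by rw [hnδ']; linarith
  have hright (j : ℕ) (hj : j < L) : climbTime p q (K₂ + 1 + j) ≤ B / δ * E := by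
    have h := climbTime_le_of_drift_ge (D := c₃ + β) (K := K₂) (L := L) (p := p) (q := q) ha0
      (by positivity) hδ hB1 (fun i hi => hpa (by omega)) (fun i _ => hq0 _) (fun i hi => ?_) ?_
      (j + 1) hj
    · rw [show K₂ + 1 + j = K₂ + (j + 1) by omega]
      refine h.trans ?_
      gcongr
      have h1 : 1 + (c₃ + β + 1) / a * δ ≤ Real.exp ((c₃ + β + 1) / a * δ) := by
        rw [add_comm]
        exact Real.add_one_le_exp _
      have h2 : ((j + 1 : ℕ) : ℝ) ≤ L := by exact_mod_cast hj
      calc _ ≤ Real.exp ((c₃ + β + 1) / a * δ) ^ (j + 1) := by gcongr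
        _ = Real.exp ((c₃ + β + 1) / a * (δ * (j + 1 : ℕ))) := by
          rw [← Real.exp_nat_mul]
          ring_nf
        _ ≤ E := by
          rw [hE]
          gcongr
          exact le_trans (by gcongr) hLδ
    · have h1 := hMlt (show K₂ + 1 + i < M by omega)
      refine le_trans ?_ (drift_above hβ hfix (by positivity) (hK₂lt (by omega)) (by linarith))
      rw [hnδ]
      have : β * δ ^ 2 ≤ β * δ := by gcongr; nlinarith
      linarith
    · refine (hmid K₂ hK₁₂ le_rfl).trans ?_
      gcongr
      linarith [hK₂le le_rfl]
  have hK₂n : ((K₂ + 1 : ℕ) : ℝ) ≤ n := by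
    have h1 : K₂ < n := by
      rw [hK₂, Nat.floor_lt (by positivity)]
      nlinarith
    exact_mod_cast h1
  have hlog : 0 ≤ Real.log n := Real.log_nonneg hn1
  have hsum := sum_inv_le hK₂n hn1
  have hA' : ∑ k ∈ Finset.range (K₂ + 1), A * n / ((k : ℝ) + 1) ≤ A * n * (1 + Real.log n) := by
    simp only [div_eq_mul_inv, ← Finset.mul_sum]
    gcongr
  have hB' : ∑ k ∈ Finset.range (K₂ + 1), B * n / ((K₂ - k : ℕ) + 1 : ℝ) ≤
      B * n * (1 + Real.log n) := by
    have h := Finset.sum_range_reflect (fun k : ℕ => B * n / ((k : ℝ) + 1)) (K₂ + 1)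
    simp only [Nat.add_sub_cancel] at h
    rw [h]
    simp only [div_eq_mul_inv, ← Finset.mul_sum]
    gcongr
  rw [hL, Finset.sum_range_add]
  have hpart1 : ∑ k ∈ Finset.range (K₂ + 1), magClimbTime β n k ≤
      (A + B) * n * (1 + Real.log n) := by
    calc _ ≤ ∑ k ∈ Finset.range (K₂ + 1),
          (A * n / ((k : ℝ) + 1) + B * n / ((K₂ - k : ℕ) + 1 : ℝ)) := by
          refine Finset.sum_le_sum fun k hk => ?_
          have hk' : k ≤ K₂ := by simpa [Nat.lt_succ_iff] using hk
          have h1 : 0 ≤ A * n / ((k : ℝ) + 1) := by positivity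
          have h2 : 0 ≤ B * n / ((K₂ - k : ℕ) + 1 : ℝ) := by positivity
          rcases le_total k K₁ with h | h
          · exact (hleft k h).trans (by linarith)
          · exact (hmid' k h hk').trans (by linarith)
      _ ≤ _ := by
          rw [Finset.sum_add_distrib]
          linarith
  have hpart2 : ∑ j ∈ Finset.range L, magClimbTime β n (K₂ + 1 + j) ≤
      B * ((c₃ + 1) * E) * n * (1 + Real.log n) := by
    calc _ ≤ ∑ _j ∈ Finset.range L, B / δ * E :=
          Finset.sum_le_sum fun j hj => hright j (Finset.mem_range.1 hj)
      _ = (δ * L) * (B * E) * n := by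
          rw [Finset.sum_const, Finset.card_range, nsmul_eq_mul]
          field_simp
          linear_combination (-(L * E)) * hnδ'
      _ ≤ (c₃ + 1) * (B * E) * n := by
          have : 0 < E := Real.exp_pos _
          gcongr
      _ ≤ (c₃ + 1) * (B * E) * n * (1 + Real.log n) := by
          have : 0 < E := Real.exp_pos _
          exact le_mul_of_one_le_right (by positivity) (by linarith)
      _ = _ := by ring
  calc _ ≤ _ := add_le_add hpart1 hpart2
    _ = _ := by ring

theorem tsum_surviveBelow_le {β b : ℝ} {n : ℕ} (hβ : 0 ≤ β) (hn : 0 < n) (hb : b < 1)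
    {σ : Config n} (hσ : mag σ = 0) :
    ∑' T : ℕ, ENNReal.ofReal (surviveBelow β n b T σ) ≤
      ENNReal.ofReal (∑ k ∈ Finset.range ⌈b * n / 2⌉₊, magClimbTime β n k) := by
  have hn' : (0 : ℝ) < n := by exact_mod_cast hn
  set M := ⌈b * n / 2⌉₊ with hM
  set m := plusCount σ with hm
  have hmn : (n : ℝ) = 2 * m := by
    rw [mag_eq, div_eq_zero_iff] at hσ
    rcases hσ with h | h
    · linarith
    · exact absurd h hn'.ne'
  have hmn' : (n : ℤ) = 2 * m := by exact_mod_cast hmn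
  have hMlt (k : ℕ) : k < M ↔ 2 * (k : ℝ) / n < b := by
    rw [hM, Nat.lt_ceil, div_lt_iff₀ hn']
    constructor <;> intro h <;> linarith
  have hup (k : ℕ) (hk : k < M) : 0 < upProb β (1 / n) (2 * k / n) := by
    have := (hMlt k).1 hk
    exact lt_of_lt_of_le (by linarith)
      (upProb_ge hβ (by positivity) (by positivity) (by linarith))
  have hdown (k : ℕ) : 0 ≤ downProb β (1 / n) (2 * k / n) := downProb_nonneg (by positivity)
  have hclimb (k : ℕ) (hk : k < M) : 0 ≤ magClimbTime β n k :=
    climbTime_nonneg (fun j hj => (hup j (by omega)).le) fun j _ => hdown j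
  set f : ℕ → ℝ := fun k => ∑ j ∈ Finset.Ico k M, magClimbTime β n j with hf
  have hfsucc (k : ℕ) (hk : k < M) : f k = magClimbTime β n k + f (k + 1) :=
    Finset.sum_eq_sum_Ico_succ_bot hk _
  set φ : ℤ → ℝ := fun z => f (z - m).natAbs with hφ
  have hneg (η : Config n) : φ (plusCount (negConfig η)) = φ (plusCount η) := by
    simp only [hφ]
    congr 1
    rw [plusCount_negConfig, hmn']
    omega
  have hbound (T : ℕ) : ∑ t ∈ Finset.range T, surviveBelow β n b t σ ≤ φ (plusCount σ) := by
    refine sum_surviveBelow_le (F := fun η => φ (plusCount η)) ?_ ?_ T σ hσ.ge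
    · intro η
      exact Finset.sum_nonneg fun j hj => hclimb j (Finset.mem_Ico.1 hj).2
    · intro η h0 hηb
      rw [sum_rKernel_mul _ _ _ _ hneg, sum_glauberKernel_mul_plusCount _ hn]
      have hmag : mag η = 2 * ((plusCount η - m : ℤ) : ℝ) / n := by
        rw [mag_eq, hmn]
        push_cast
        ring
      obtain ⟨k, hk⟩ : ∃ k : ℕ, plusCount η - m = k := by
        refine Int.eq_ofNat_of_zero_le ?_
        rw [hmag, le_div_iff₀ hn', zero_mul] at h0
        have : (0 : ℝ) ≤ ((plusCount η - m : ℤ) : ℝ) := by linarith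
        exact_mod_cast this
      rw [hk, Int.cast_natCast] at hmag
      rw [hmag] at hηb ⊢
      have hkM := (hMlt k).2 hηb
      have e0 : φ (plusCount η) = f k := by
        simp only [hφ]
        congr 1
        omega
      have e1 : φ (plusCount η + 1) = f (k + 1) := by
        simp only [hφ]
        congr 1
        omega
      rw [e0, e1]
      have hs := hfsucc k hkM
      have hpk := hup k hkM
      have hqk := hdown k
      rcases k with _ | k
      · have e2 : φ (plusCount η - 1) = f 1 := by
          simp only [hφ]
          congr 1
          omega
        rw [e2]
        have hh : upProb β (1 / n) (2 * (0 : ℕ) / n) * magClimbTime β n 0 = 1 := by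
          rw [magClimbTime, climbTime]
          field_simp
        have h3 := mul_nonneg hqk (hclimb 0 hkM)
        rw [zero_add] at hs ⊢
        rw [hs]
        linarith
      · have e2 : φ (plusCount η - 1) = f k := by
          simp only [hφ]
          congr 1
          omega
        rw [e2]
        have hh : upProb β (1 / n) (2 * (k + 1 : ℕ) / n) * magClimbTime β n (k + 1) =
            1 + downProb β (1 / n) (2 * (k + 1 : ℕ) / n) * magClimbTime β n k := by
          rw [magClimbTime, climbTime]
          exact mul_div_cancel₀ _ hpk.ne'
        rw [hfsucc k (by omega), hs]
        linarith
  have hφσ : φ (plusCount σ) = ∑ k ∈ Finset.range M, magClimbTime β n k := by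
    simp [hφ, hf, ← hm]
  rw [← hφσ]
  refine ENNReal.tsum_le_of_sum_range_le fun T => ?_
  rw [← ENNReal.ofReal_sum_of_nonneg fun t _ => surviveBelow_nonneg _ _ _ _ _]
  exact ENNReal.ofReal_le_ofReal (hbound T)

/-- Hitting the metastable magnetization from zero at low temperature: let
`β > 1`, let `s⋆` be the unique positive solution of `tanh(βs) = s`, and fix
`c₃ > 0`. With `τ_⋆ = min{t : S⁺_t ≥ s⋆ + c₃ n^{-1/2}}`, there is a constant
`C > 0` (depending on `β` and `c₃`) such that for all large `n` and any start
of magnetization `0`, `E₀[τ_⋆] ≤ C n log n` (the expectation is written as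
`∑_{T≥0} P₀(τ_⋆ > T)`). -/
theorem hitting_metastable (β : ℝ) (hβ : 1 < β) (sstar : ℝ) (hs0 : 0 < sstar)
    (hfix : Real.tanh (β * sstar) = sstar)
    (huniq : ∀ y : ℝ, 0 < y → Real.tanh (β * y) = y → y = sstar)
    (c₃ : ℝ) (hc₃ : 0 < c₃) :
    ∃ C > (0 : ℝ), ∃ N : ℕ, ∀ n ≥ N, ∀ σ : Config n, mag σ = 0 →
      (∑' T : ℕ,
          ENNReal.ofReal (surviveBelow β n (sstar + c₃ / Real.sqrt n) T σ)) ≤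
        ENNReal.ofReal (C * n * Real.log n) := by
  have hβ0 : 0 < β := by linarith
  have hs1 : sstar < 1 := hfix ▸ Real.tanh_lt_one _
  obtain ⟨c₁, hc₁, hc₁1, ε₀, hε₀, hd₁⟩ := exists_drift_near_zero hβ0 hs0 hfix
  obtain ⟨c₂, hc₂, hd₂⟩ := exists_drift_below hβ0 hs0 hfix
  obtain ⟨a, ha⟩ : ∃ a, a = (1 - sstar) / 8 := ⟨_, rfl⟩
  have ha0 : 0 < a := by rw [ha]; linarith
  set C := 4 / (a * c₁) + (6 / a + 6 / c₂ + 8 * (4 / (a * c₁)) / sstar + 1) *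
    (1 + (c₃ + 1) * Real.exp ((c₃ + β + 1) / a * (c₃ + 1))) with hC
  have hCpos : 0 < C := by positivity
  have hlim : Tendsto (fun n : ℕ => 1 / Real.sqrt n) atTop (nhds 0) := by
    exact (Real.tendsto_sqrt_atTop.comp tendsto_natCast_atTop_atTop).inv_tendsto_atTop.congr
      fun n => by simp
  have hsmall {x y : ℝ} (hx : 0 < x) (hy : 0 < y) :
      ∀ᶠ n : ℕ in atTop, x * (1 / Real.sqrt n) < y := by
    have h := hlim.const_mul x
    rw [mul_zero] at h
    exact h.eventually_lt_const hy
  have hev : ∀ᶠ n : ℕ in atTop, ∀ σ : Config n, mag σ = 0 →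
      (∑' T : ℕ,
          ENNReal.ofReal (surviveBelow β n (sstar + c₃ / Real.sqrt n) T σ)) ≤
        ENNReal.ofReal (2 * C * n * Real.log n) := by
    filter_upwards [eventually_ge_atTop 3, hsmall one_pos (show (0 : ℝ) < 1 / 2 by norm_num),
      hsmall one_pos hε₀, hsmall (x := 2 * β) (by positivity) ha0,
      hsmall (x := 2 * β) (by positivity) hc₂,
      hsmall hc₃ (show 0 < (1 - sstar) / 2 by linarith)] with n hn h1 h2 h3 h4 h5 σ hσ
    have hn0 : (0 : ℝ) < n := by positivity
    have hδ : 0 < 1 / Real.sqrt n := by positivity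
    have hnδ : (1 : ℝ) / n = (1 / Real.sqrt n) ^ 2 := by
      rw [div_pow, Real.sq_sqrt hn0.le, one_pow]
    have hlog : 1 ≤ Real.log n := by
      rw [Real.le_log_iff_exp_le hn0]
      have : (3 : ℝ) ≤ n := by exact_mod_cast hn
      linarith [Real.exp_one_lt_d9]
    refine (tsum_surviveBelow_le hβ0.le (by omega) ?_ hσ).trans (ENNReal.ofReal_le_ofReal ?_)
    · rw [div_eq_mul_one_div]
      linarith
    · rw [div_eq_mul_one_div c₃]
      refine (magClimbTime_le hβ0 hs0 hfix hc₃ ha hc₁ hc₁1 hc₂ hδ hnδ (by linarith) h3.le h4.le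
        h5.le (hd₁ _ (by positivity) ?_) (hd₂ _ (by positivity))).trans ?_
      · rw [hnδ]
        nlinarith
      · rw [← hC]
        have : 0 ≤ C * n * (Real.log n - 1) :=
          mul_nonneg (by positivity) (by linarith)
        linarith
  obtain ⟨N, hN⟩ := eventually_atTop.1 hev
  exact ⟨2 * C, by positivity, N, hN⟩

end

end CW
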